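/- Let L = ℤ¹⁰ with basis e₀, …, e₉ and the symmetric bilinear form ⟨e₀,e₀⟩ = −1, ⟨e_i,e_i⟩ = 1 (1 ≤ i ≤ 9), ⟨e_i,e_j⟩ = 0 (i ≠ j); write e_{ij} = e_i − e_j, e_{ijk} = e₀ − e_i − e_j − e_k, s_v(Λ) = Λ − ⟨v,Λ⟩·v for ⟨v,v⟩ = 2, s_{ij} = s_{e_{ij}}, s_{ijk} = s_{e_{ijk}}, c = 3e₀ − e₁ − ⋯ − e₉. Let W̃(E₇⁽¹⁾) be the group of isometries of L generated by s₁₂, s₂₃, s₃₄, s₄₅, s₅₆, s₇₈, s₈₉, s₁₂₇ and π = s₁₂₃ ∘ s₄₇ ∘ s₅₈ ∘ s₆₉; let M^{E₇} be the orbit of e₁ under W̃(E₇⁽¹⁾), and M₁ = {Λ ∈ M^{E₇} : ⟨Λ, e₈ − e₉⟩ = 1}. Let W̃(D₆⁽¹⁾) be the subgroup generated by s₁₂₇, s₁₂, s₂₃, s₃₄, s₄₅, s₅₆, s_{v₀} with v₀ = 2e₀ − e₁ − e₂ − e₃ − e₄ − e₈ − e₉, and ρ = π ∘ s₁₅₇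 ∘ s₁₆₈ ∘ s₂₄ ∘ s₂₆ ∘ s₃₅ ∘ s₇₉. Then e₈ ∈ M₁, and for every Λ ∈ M₁ there exists w ∈ W̃(D₆⁽¹⁾) with w(Λ) = e₈; that is, W̃(D₆⁽¹⁾) acts transitively on M₁. -/

import Mathlib

/-- The symmetric bilinear form on `L = ℤ¹⁰` with `⟨e₀,e₀⟩ = −1`, `⟨e_i,e_i⟩ = 1`
(`1 ≤ i ≤ 9`) and `⟨e_i,e_j⟩ = 0` (`i ≠ j`). -/
def form (x y : Fin 10 → ℤ) : ℤ := (∑ i, x i * y i) - 2 * (x 0 * y 0)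

/-- The basis vector `e_i`. -/
def ee (i : Fin 10) : Fin 10 → ℤ := fun j => if j = i then 1 else 0

/-- The root `e_{ij} = e_i − e_j`. -/
def eij (i j : Fin 10) : Fin 10 → ℤ := ee i - ee j

/-- The root `e_{ijk} = e₀ − e_i − e_j − e_k`. -/
def eijk (i j k : Fin 10) : Fin 10 → ℤ := ee 0 - ee i - ee j - ee k

/-- The reflection `s_v(Λ) = Λ − ⟨v,Λ⟩·v`. -/
def sRef (v Λ : Fin 10 → ℤ) : Fin 10 → ℤ := Λ - form v Λ • v

lemma form_sub_smul (v x : Fin 10 → ℤ) (c : ℤ) :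
    form v (x - c • v) = form v x - c * form v v := by
  simp only [form, Pi.sub_apply, Pi.smul_apply, smul_eq_mul, mul_sub, mul_left_comm,
    Finset.sum_sub_distrib, ← Finset.mul_sum]
  ring

lemma sRef_invol (v : Fin 10 → ℤ) (hv : form v v = 2) :
    Function.Involutive (sRef v) := by
  intro x
  unfold sRef
  rw [form_sub_smul, hv]
  ext i
  simp only [Pi.sub_apply, Pi.smul_apply, smul_eq_mul]
  ring

/-- The reflection `s_v` as a permutation of the lattice, for `v` of square length 2. -/
def rPerm (v : Fin 10 → ℤ) (hv : form v v = 2) : Equiv.Perm (Fin 10 → ℤ) :=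
  (sRef_invol v hv).toPerm

/-- The Dynkin diagram automorphism `π = s₁₂₃ s₄₇ s₅₈ s₆₉`. -/
def piPerm : Equiv.Perm (Fin 10 → ℤ) :=
  rPerm (eijk 1 2 3) (by decide) * rPerm (eij 4 7) (by decide) *
    rPerm (eij 5 8) (by decide) * rPerm (eij 6 9) (by decide)

/-- The extended affine Weyl group
`W̃(E₇⁽¹⁾) = ⟨s₁₂, s₂₃, s₃₄, s₄₅, s₅₆, s₇₈, s₈₉, s₁₂₇, π⟩`. -/
def WE7 : Subgroup (Equiv.Perm (Fin 10 → ℤ)) :=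
  Subgroup.closure
    {rPerm (eij 1 2) (by decide), rPerm (eij 2 3) (by decide),
     rPerm (eij 3 4) (by decide), rPerm (eij 4 5) (by decide),
     rPerm (eij 5 6) (by decide), rPerm (eij 7 8) (by decide),
     rPerm (eij 8 9) (by decide), rPerm (eijk 1 2 7) (by decide), piPerm}

/-- `M^{E₇}`, the orbit of `e₁` under `W̃(E₇⁽¹⁾)`. -/
def ME7 : Set (Fin 10 → ℤ) := {Λ | ∃ w ∈ WE7, w (ee 1) = Λ}

/-- `M₁ = {Λ ∈ M^{E₇} : ⟨Λ, e₈ − e₉⟩ = 1}`. -/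
def M1 : Set (Fin 10 → ℤ) := {Λ | Λ ∈ ME7 ∧ form Λ (ee 8 - ee 9) = 1}

/-- `v₀ = 2e₀ − e₁ − e₂ − e₃ − e₄ − e₈ − e₉`, the remaining simple root of `D₆⁽¹⁾`. -/
def v0 : Fin 10 → ℤ := ![2, -1, -1, -1, -1, 0, 0, 0, -1, -1]

/-- The Dynkin diagram automorphism `ρ = π s₁₅₇ s₁₆₈ s₂₄ s₂₆ s₃₅ s₇₉` of `D₆⁽¹⁾`. -/
def rhoPerm : Equiv.Perm (Fin 10 → ℤ) :=
  piPerm * rPerm (eijk 1 5 7) (by decide) * rPerm (eijk 1 6 8) (by decide) *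
    rPerm (eij 2 4) (by decide) * rPerm (eij 2 6) (by decide) *
    rPerm (eij 3 5) (by decide) * rPerm (eij 7 9) (by decide)

/-- The extended affine Weyl group
`W̃(D₆⁽¹⁾) = ⟨s₁₂₇, s₁₂, s₂₃, s₃₄, s₄₅, s₅₆, s_{v₀}, ρ⟩`. -/
def WD6 : Subgroup (Equiv.Perm (Fin 10 → ℤ)) :=
  Subgroup.closure
    {rPerm (eijk 1 2 7) (by decide), rPerm (eij 1 2) (by decide),
     rPerm (eij 2 3) (by decide), rPerm (eij 3 4) (by decide),
     rPerm (eij 4 5) (by decide), rPerm (eij 5 6) (by decide),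
     rPerm v0 (by decide), rhoPerm}

lemma form_comm (x y : Fin 10 → ℤ) : form x y = form y x := by
  simp only [form, mul_comm]

lemma form_add_right (v x y : Fin 10 → ℤ) : form v (x + y) = form v x + form v y := by
  simp only [form, Pi.add_apply, mul_add, Finset.sum_add_distrib]
  ring

lemma form_smul_right (v x : Fin 10 → ℤ) (c : ℤ) : form v (c • x) = c * form v x := by
  simp only [form, Pi.smul_apply, smul_eq_mul, mul_left_comm _ c, ← Finset.mul_sum]
  ring

lemma form_sub_right (v x y : Fin 10 → ℤ) : form v (x - y) = form v x - form v y := by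
  simp only [form, Pi.sub_apply, mul_sub, Finset.sum_sub_distrib]
  ring

lemma form_add_left (x y v : Fin 10 → ℤ) : form (x + y) v = form x v + form y v := by
  rw [form_comm, form_add_right, form_comm v, form_comm v]

lemma form_smul_left (x v : Fin 10 → ℤ) (c : ℤ) : form (c • x) v = c * form x v := by
  rw [form_comm, form_smul_right, form_comm v]

lemma form_sub_left (x y v : Fin 10 → ℤ) : form (x - y) v = form x v - form y v := by
  rw [form_comm, form_sub_right, form_comm v, form_comm v]

lemma sRef_isometry (v : Fin 10 → ℤ) (hv : form v v = 2) (x y : Fin 10 → ℤ) :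
    form (sRef v x) (sRef v y) = form x y := by
  simp only [sRef, form_sub_right, form_sub_left, form_smul_right, form_smul_left, hv,
    form_comm x v]
  ring

lemma sRef_sRef (w v : Fin 10 → ℤ) (hw : form w w = 2) (x : Fin 10 → ℤ) :
    sRef w (sRef v (sRef w x)) = sRef (sRef w v) x := by
  have h : form v (sRef w x) = form (sRef w v) x := by
    rw [← sRef_isometry w hw v, sRef_invol w hw x]
  have h' : sRef w (sRef w x - form v (sRef w x) • v)
      = sRef w (sRef w x) - form v (sRef w x) • sRef w v := by
    simp only [sRef, form_sub_right, form_smul_right]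
    module
  rw [show sRef v (sRef w x) = sRef w x - form v (sRef w x) • v from rfl, h', h,
    sRef_invol w hw x]
  rfl

/-- The isometries of the lattice, as a subgroup of its permutations. -/
def isometrySubgroup : Subgroup (Equiv.Perm (Fin 10 → ℤ)) where
  carrier := {w | ∀ x y, form (w x) (w y) = form x y}
  one_mem' := fun _ _ => rfl
  mul_mem' := fun {a b} ha hb x y => (ha (b x) (b y)).trans (hb x y)
  inv_mem' := fun {a} ha x y => by
    have h := ha (a⁻¹ x) (a⁻¹ y)
    rw [← Equiv.Perm.mul_apply, ← Equiv.Perm.mul_apply, mul_inv_cancel] at h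
    exact h.symm

lemma rPerm_mem_isometrySubgroup (v : Fin 10 → ℤ) (hv : form v v = 2) :
    rPerm v hv ∈ isometrySubgroup :=
  sRef_isometry v hv

lemma piPerm_mem_isometrySubgroup : piPerm ∈ isometrySubgroup := by
  unfold piPerm
  refine mul_mem (mul_mem (mul_mem ?_ ?_) ?_) ?_ <;> exact rPerm_mem_isometrySubgroup _ _

lemma rhoPerm_mem_isometrySubgroup : rhoPerm ∈ isometrySubgroup := by
  unfold rhoPerm
  refine mul_mem (mul_mem (mul_mem (mul_mem (mul_mem (mul_mem
    piPerm_mem_isometrySubgroup ?_) ?_) ?_) ?_) ?_) ?_ <;> exact rPerm_mem_isometrySubgroup _ _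

lemma WE7_le_isometrySubgroup : WE7 ≤ isometrySubgroup := by
  refine (Subgroup.closure_le _).2 ?_
  rintro w (rfl | rfl | rfl | rfl | rfl | rfl | rfl | rfl | rfl)
  on_goal 9 => exact piPerm_mem_isometrySubgroup
  all_goals exact rPerm_mem_isometrySubgroup _ _

lemma WD6_le_isometrySubgroup : WD6 ≤ isometrySubgroup := by
  refine (Subgroup.closure_le _).2 ?_
  rintro w (rfl | rfl | rfl | rfl | rfl | rfl | rfl | rfl)
  on_goal 8 => exact rhoPerm_mem_isometrySubgroup
  all_goals exact rPerm_mem_isometrySubgroup _ _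

/-- The component `e₀ − e₇ − e₈ − e₉` of the anticanonical class. -/
abbrev lineClass : Fin 10 → ℤ := ![1, 0, 0, 0, 0, 0, 0, -1, -1, -1]

/-- The component `2e₀ − e₁ − ⋯ − e₆` of the anticanonical class. -/
abbrev conicClass : Fin 10 → ℤ := ![2, -1, -1, -1, -1, -1, -1, 0, 0, 0]

/-- The anticanonical class `c = 3e₀ − e₁ − ⋯ − e₉`. -/
abbrev cc : Fin 10 → ℤ := ![3, -1, -1, -1, -1, -1, -1, -1, -1, -1]

/-- The group `W̃(E₇⁽¹⁾)` permutes the two components of the anticanonical class. -/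
lemma WE7_permutes_components (w : Equiv.Perm (Fin 10 → ℤ)) (hw : w ∈ WE7) :
    (w lineClass = lineClass ∧ w conicClass = conicClass) ∨
      (w lineClass = conicClass ∧ w conicClass = lineClass) := by
  induction hw using Subgroup.closure_induction with
  | mem w hw =>
    rcases hw with rfl | rfl | rfl | rfl | rfl | rfl | rfl | rfl | rfl
    on_goal 9 => exact Or.inr ⟨by decide, by decide⟩
    all_goals exact Or.inl ⟨by decide, by decide⟩
  | one => exact Or.inl ⟨rfl, rfl⟩
  | mul a b _ _ ha hb =>
    simp only [Equiv.Perm.mul_apply]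
    rcases ha with ⟨h₁, h₂⟩ | ⟨h₁, h₂⟩ <;> rcases hb with ⟨h₃, h₄⟩ | ⟨h₃, h₄⟩ <;>
      simp only [h₁, h₂, h₃, h₄, and_self, true_or, or_true]
  | inv a _ ha =>
    simp only [Equiv.Perm.inv_eq_iff_eq]
    rcases ha with ⟨h₁, h₂⟩ | ⟨h₁, h₂⟩ <;>
      simp only [h₁, h₂, and_self, true_or, or_true]

lemma ME7_invariants {Λ : Fin 10 → ℤ} (hΛ : Λ ∈ ME7) :
    form Λ Λ = 1 ∧ ((form lineClass Λ = -1 ∧ form conicClass Λ = 0) ∨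
      (form lineClass Λ = 0 ∧ form conicClass Λ = -1)) := by
  obtain ⟨w, hw, rfl⟩ := hΛ
  have hiso := WE7_le_isometrySubgroup hw
  refine ⟨(hiso _ _).trans (by decide), ?_⟩
  have h₁ := (hiso lineClass (ee 1)).trans (show _ = 0 by decide)
  have h₂ := (hiso conicClass (ee 1)).trans (show _ = -1 by decide)
  rcases WE7_permutes_components w hw with ⟨h₃, h₄⟩ | ⟨h₃, h₄⟩ <;> rw [h₃] at h₁ <;>
    rw [h₄] at h₂
  · exact Or.inr ⟨h₁, h₂⟩
  · exact Or.inl ⟨h₂, h₁⟩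

lemma ee_eight_mem_M1 : ee 8 ∈ M1 := by
  refine ⟨⟨piPerm * rPerm (eij 4 5) (by decide) * rPerm (eij 3 4) (by decide) *
    rPerm (eij 2 3) (by decide) * rPerm (eij 1 2) (by decide), ?_, by decide⟩, by decide⟩
  refine mul_mem (mul_mem (mul_mem (mul_mem ?_ ?_) ?_) ?_) ?_ <;>
    exact Subgroup.subset_closure (by simp)

/-- A vector of square length 2 whose reflection belongs to `W̃(D₆⁽¹⁾)`. -/
def IsRootD6 (v : Fin 10 → ℤ) : Prop :=
  form v v = 2 ∧ ∃ f ∈ WD6, ∀ x, f x = sRef v x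

lemma IsRootD6.sRef {v w : Fin 10 → ℤ} (hw : IsRootD6 w) (hv : IsRootD6 v) :
    IsRootD6 (sRef w v) := by
  obtain ⟨hww, f, hf, hfx⟩ := hw
  obtain ⟨hvv, g, hg, hgx⟩ := hv
  refine ⟨by rw [sRef_isometry w hww, hvv], f * g * f, mul_mem (mul_mem hf hg) hf, fun x => ?_⟩
  simp only [Equiv.Perm.mul_apply, hfx, hgx, sRef_sRef w v hww]

lemma isRootD6_of_mem {v : Fin 10 → ℤ} (hv : form v v = 2) (h : rPerm v hv ∈ WD6) :
    IsRootD6 v :=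
  ⟨hv, _, h, fun _ => rfl⟩

lemma isRootD6_eijk : IsRootD6 (eijk 1 2 7) :=
  isRootD6_of_mem (by decide) (Subgroup.subset_closure (by simp))

lemma isRootD6_e12 : IsRootD6 (eij 1 2) :=
  isRootD6_of_mem (by decide) (Subgroup.subset_closure (by simp))

lemma isRootD6_e23 : IsRootD6 (eij 2 3) :=
  isRootD6_of_mem (by decide) (Subgroup.subset_closure (by simp))

lemma isRootD6_e34 : IsRootD6 (eij 3 4) :=
  isRootD6_of_mem (by decide) (Subgroup.subset_closure (by simp))

lemma isRootD6_e45 : IsRootD6 (eij 4 5) :=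
  isRootD6_of_mem (by decide) (Subgroup.subset_closure (by simp))

lemma isRootD6_e56 : IsRootD6 (eij 5 6) :=
  isRootD6_of_mem (by decide) (Subgroup.subset_closure (by simp))

lemma isRootD6_v0 : IsRootD6 v0 :=
  isRootD6_of_mem (by decide) (Subgroup.subset_closure (by simp))

/-- The highest root of `D₆` is `c − v₀`. -/
lemma isRootD6_cc_sub_v0 : IsRootD6 (cc - v0) := by
  have h := isRootD6_e45.sRef <| isRootD6_e34.sRef <| isRootD6_e23.sRef <|
    isRootD6_eijk.sRef <| isRootD6_e12.sRef <| isRootD6_e23.sRef <| isRootD6_e34.sRef <|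
    isRootD6_e45.sRef isRootD6_e56
  convert h using 1
  decide

/-- If `v`, `w` are adjacent roots and `c − v` is a root then so is `c − w`. -/
lemma IsRootD6.cc_sub {v w : Fin 10 → ℤ} (hv : IsRootD6 v) (hw : IsRootD6 w)
    (h : IsRootD6 (cc - v)) (hvw : _root_.sRef v (_root_.sRef w (cc - v)) = cc - w) :
    IsRootD6 (cc - w) :=
  hvw ▸ hv.sRef (hw.sRef h)

lemma isRootD6_cc_sub_e45 : IsRootD6 (cc - eij 4 5) :=
  isRootD6_v0.cc_sub isRootD6_e45 isRootD6_cc_sub_v0 (by decide)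

lemma isRootD6_cc_sub_e56 : IsRootD6 (cc - eij 5 6) :=
  isRootD6_e45.cc_sub isRootD6_e56 isRootD6_cc_sub_e45 (by decide)

lemma isRootD6_cc_sub_e34 : IsRootD6 (cc - eij 3 4) :=
  isRootD6_e45.cc_sub isRootD6_e34 isRootD6_cc_sub_e45 (by decide)

lemma isRootD6_cc_sub_e23 : IsRootD6 (cc - eij 2 3) :=
  isRootD6_e34.cc_sub isRootD6_e23 isRootD6_cc_sub_e34 (by decide)

lemma isRootD6_cc_sub_e12 : IsRootD6 (cc - eij 1 2) :=
  isRootD6_e23.cc_sub isRootD6_e12 isRootD6_cc_sub_e23 (by decide)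

lemma isRootD6_cc_sub_eijk : IsRootD6 (cc - eijk 1 2 7) :=
  isRootD6_e23.cc_sub isRootD6_eijk isRootD6_cc_sub_e23 (by decide)

/-- The vectors `u` orthogonal to `c` such that `W̃(D₆⁽¹⁾)` realizes both translations by
`± u`, modulo `c`, on the vectors `x` with `⟨c, x⟩ = −1`. -/
def translationSubgroup : AddSubgroup (Fin 10 → ℤ) where
  carrier := {u | form cc u = 0 ∧ ∀ x, form cc x = -1 →
    (∃ w ∈ WD6, ∃ k : ℤ, w x = x + u + k • cc) ∧ ∃ w ∈ WD6, ∃ k : ℤ, w x = x - u + k • cc}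
  zero_mem' := ⟨by decide, fun x _ =>
    ⟨⟨1, one_mem _, 0, by simp⟩, ⟨1, one_mem _, 0, by simp⟩⟩⟩
  neg_mem' := by
    rintro u ⟨hu, h⟩
    refine ⟨by rw [← neg_one_smul ℤ u, form_smul_right, hu, mul_zero], fun x hx => ?_⟩
    simpa only [sub_neg_eq_add, ← sub_eq_add_neg] using (h x hx).symm
  add_mem' := by
    rintro u v ⟨hu, h⟩ ⟨hv, h'⟩
    refine ⟨by rw [form_add_right, hu, hv, add_zero], fun x hx => ⟨?_, ?_⟩⟩
    · obtain ⟨w, hw, k, hk⟩ := (h x hx).1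
      have hy : form cc (w x) = -1 := by
        rw [hk, form_add_right, form_add_right, form_smul_right, hx, hu,
          show form cc cc = 0 by decide]
        ring
      obtain ⟨w', hw', k', hk'⟩ := (h' _ hy).1
      refine ⟨w' * w, mul_mem hw' hw, k + k', ?_⟩
      rw [Equiv.Perm.mul_apply, hk', hk]
      module
    · obtain ⟨w, hw, k, hk⟩ := (h x hx).2
      have hy : form cc (w x) = -1 := by
        rw [hk, form_add_right, form_sub_right, form_smul_right, hx, hu,
          show form cc cc = 0 by decide]
        ring
      obtain ⟨w', hw', k', hk'⟩ := (h' _ hy).2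
      refine ⟨w' * w, mul_mem hw' hw, k + k', ?_⟩
      rw [Equiv.Perm.mul_apply, hk', hk]
      module

lemma sRef_cc_sub_sRef {v x : Fin 10 → ℤ} (hv : form v v = 2) (hcv : form cc v = 0)
    (hx : form cc x = -1) :
    sRef (cc - v) (sRef v x) = x - v + (1 - form v x) • cc := by
  simp only [sRef, form_sub_left, form_sub_right, form_smul_right, hv, hcv, hx]
  module

lemma mem_translationSubgroup {v : Fin 10 → ℤ} (h : IsRootD6 v) (h' : IsRootD6 (cc - v))
    (hcv : form cc v = 0) : v ∈ translationSubgroup := by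
  obtain ⟨hv, f, hf, hfx⟩ := h
  obtain ⟨hv', g, hg, hgx⟩ := h'
  refine ⟨hcv, fun x hx => ⟨⟨f * g, mul_mem hf hg, 1 - form (cc - v) x - 1, ?_⟩,
    ⟨g * f, mul_mem hg hf, 1 - form v x, ?_⟩⟩⟩
  · have h := sRef_cc_sub_sRef hv' (by rw [form_sub_right, hcv]; decide) hx
    rw [sub_sub_cancel] at h
    rw [Equiv.Perm.mul_apply, hfx, hgx, h]
    module
  · rw [Equiv.Perm.mul_apply, hfx, hgx, sRef_cc_sub_sRef hv hcv hx]

lemma form_eq (x y : Fin 10 → ℤ) : form x y = -(x 0 * y 0) + x 1 * y 1 + x 2 * y 2 + x 3 * y 3 +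
    x 4 * y 4 + x 5 * y 5 + x 6 * y 6 + x 7 * y 7 + x 8 * y 8 + x 9 * y 9 := by
  simp only [form, Fin.sum_univ_succ, Fin.sum_univ_zero, Fin.succ_zero_eq_one]
  simp only [Fin.isValue, Fin.reduceSucc]
  ring

/-- The lattice orthogonal to both components of `c` and to `e₈ − e₉` is spanned by the
simple roots of `D₆⁽¹⁾`. -/
lemma mem_translationSubgroup_of_orthogonal {u : Fin 10 → ℤ} (h₁ : form lineClass u = 0)
    (h₂ : form conicClass u = 0) (h₃ : form u (ee 8 - ee 9) = 0) :
    u ∈ translationSubgroup := by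
  have hu : u = (u 0 + 2 * u 8) • eijk 1 2 7 + (u 0 + u 1 + u 8) • eij 1 2 +
      (2 * u 0 + u 1 + u 2 + 2 * u 8) • eij 2 3 +
      (2 * u 0 + u 1 + u 2 + u 3 + u 8) • eij 3 4 +
      (2 * u 0 + u 1 + u 2 + u 3 + u 4) • eij 4 5 + (-u 6) • eij 5 6 + (-u 8) • v0 := by
    simp [form_eq, ee] at h₁ h₂ h₃
    funext i
    fin_cases i <;> simp [eijk, eij, ee, v0] <;> omega
  rw [hu]
  refine add_mem (add_mem (add_mem (add_mem (add_mem (add_mem ?_ ?_) ?_) ?_) ?_) ?_) ?_ <;>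
    refine zsmul_mem ?_ _
  · exact mem_translationSubgroup isRootD6_eijk isRootD6_cc_sub_eijk (by decide)
  · exact mem_translationSubgroup isRootD6_e12 isRootD6_cc_sub_e12 (by decide)
  · exact mem_translationSubgroup isRootD6_e23 isRootD6_cc_sub_e23 (by decide)
  · exact mem_translationSubgroup isRootD6_e34 isRootD6_cc_sub_e34 (by decide)
  · exact mem_translationSubgroup isRootD6_e45 isRootD6_cc_sub_e45 (by decide)
  · exact mem_translationSubgroup isRootD6_e56 isRootD6_cc_sub_e56 (by decide)
  · exact mem_translationSubgroup isRootD6_v0 isRootD6_cc_sub_v0 (by decide)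

lemma exists_WD6_apply_eq_ee_eight {Λ : Fin 10 → ℤ} (hΛ : form Λ Λ = 1)
    (h₁ : form lineClass Λ = -1) (h₂ : form conicClass Λ = 0)
    (h₃ : form Λ (ee 8 - ee 9) = 1) : ∃ w ∈ WD6, w Λ = ee 8 := by
  have hmem : ee 8 - Λ ∈ translationSubgroup := by
    apply mem_translationSubgroup_of_orthogonal
    · rw [form_sub_right, h₁]; decide
    · rw [form_sub_right, h₂]; decide
    · rw [form_sub_left, h₃]; decide
  have hc : form cc Λ = -1 := by
    rw [show cc = lineClass + conicClass by decide, form_add_left, h₁, h₂]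
    rfl
  obtain ⟨w, hw, k, hk⟩ := (hmem.2 Λ hc).1
  rw [add_sub_cancel] at hk
  have hnorm := (WD6_le_isometrySubgroup hw Λ Λ).trans hΛ
  simp only [hk, form_add_left, form_add_right, form_smul_left, form_smul_right,
    show form (ee 8) (ee 8) = 1 by decide, show form cc (ee 8) = -1 by decide,
    show form (ee 8) cc = -1 by decide, show form cc cc = 0 by decide] at hnorm
  obtain rfl : k = 0 := by omega
  exact ⟨w, hw, by rw [hk, zero_smul, add_zero]⟩

/-- `e₈ ∈ M₁`, and `W̃(D₆⁽¹⁾)` acts transitively on `M₁`: every `Λ ∈ M₁` can be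
transformed to `e₈` by an element of `W̃(D₆⁽¹⁾)`. -/
theorem WD6_transitive_on_M1 :
    ee 8 ∈ M1 ∧ ∀ Λ ∈ M1, ∃ w ∈ WD6, w Λ = ee 8 := by
  refine ⟨ee_eight_mem_M1, fun Λ hΛ => ?_⟩
  obtain ⟨hnorm, ⟨h₁, h₂⟩ | ⟨h₁, h₂⟩⟩ := ME7_invariants hΛ.1
  · exact exists_WD6_apply_eq_ee_eight hnorm h₁ h₂ hΛ.2
  · have hiso := rhoPerm_mem_isometrySubgroup
    have hρ : rhoPerm ∈ WD6 := Subgroup.subset_closure (by simp)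
    obtain ⟨w, hw, hwx⟩ := exists_WD6_apply_eq_ee_eight (Λ := rhoPerm Λ)
      ((hiso Λ Λ).trans hnorm)
      (by rw [show lineClass = rhoPerm conicClass by decide, hiso, h₂])
      (by rw [show conicClass = rhoPerm lineClass by decide, hiso, h₁])
      (by rw [show ee 8 - ee 9 = rhoPerm (ee 8 - ee 9) by decide, hiso, hΛ.2])
    exact ⟨w * rhoPerm, mul_mem hw hρ, hwx⟩
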